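/- Normalization of the density λ^{(δ)} on the circle: For every δ ∈ ℂ with Re δ > −1/2, (1/2π)·∫₀^{2π} (1−e^{iθ})^{conj δ}·(1−e^{−iθ})^{δ} dθ = Γ(1+δ+conj δ) / (Γ(1+δ)·Γ(1+conj δ)); consequently λ^{(δ)}(ζ) = [Γ(1+δ)Γ(1+conj δ)/Γ(1+δ+conj δ)]·(1−ζ)^{conj δ}(1−conj ζ)^{δ} is a probability density on the unit circle with respect to the normalized arc-length measure dθ/2π. -/

import Mathlib

open MeasureTheory Complex Finset intervalIntegral
open scoped Real ComplexConjugate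

noncomputable section

/-- The real integral behind the normalization. -/
def KK (p b : ℝ) : ℝ :=
  ∫ x in (0:ℝ)..(π / 2), Real.cos x ^ p * Real.cosh (2 * b * x)

lemma KK_cos_pos {x : ℝ} (h0 : 0 ≤ x) (h1 : x < π / 2) : 0 < Real.cos x :=
  Real.cos_pos_of_mem_Ioo ⟨by linarith [Real.pi_pos], h1⟩

lemma KK_cos_int {p : ℝ} (hp : -1 < p) :
    IntervalIntegrable (fun x => Real.cos x ^ p) volume 0 (π / 2) := by
  rcases le_or_gt 0 p with h | h
  · apply Continuous.intervalIntegrable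
    exact Real.continuous_cos.rpow_const (fun x => Or.inr h)
  · have h1 : IntervalIntegrable (fun x : ℝ => x ^ p) volume (1 - 2 / π * 0) (1 - 2 / π * (π / 2)) :=
      intervalIntegral.intervalIntegrable_rpow' hp
    have hpi := Real.pi_pos
    have h2 : IntervalIntegrable (fun x : ℝ => (1 - 2 / π * x) ^ p) volume 0 (π / 2) := by
      have h3 : IntervalIntegrable (fun x : ℝ => x ^ p) volume 0 (π / 2) :=
        intervalIntegral.intervalIntegrable_rpow' hp
      have h4 := (h3.comp_sub_left (π / 2)).symm
      simp only [sub_self, sub_zero] at h4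
      have h5 := h4.const_mul ((2 / π) ^ p)
      refine h5.congr ?_
      intro x hx
      rw [Set.uIoc_of_le (by positivity)] at hx
      simp only
      rw [← Real.mul_rpow (by positivity) (by linarith [hx.2])]
      congr 1
      field_simp
    refine h2.mono_fun ?_ ?_
    · exact (Real.measurable_cos.pow_const p).aestronglyMeasurable
    · have : ∀ᵐ x : ℝ, x ≠ π / 2 := by simp [ae_iff]
      rw [Filter.EventuallyLE, ae_restrict_iff' measurableSet_uIoc]
      filter_upwards [this] with x hx hx'
      rw [Set.uIoc_of_le (by positivity)] at hx'
      have hlt : x < π / 2 := lt_of_le_of_ne hx'.2 hx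
      have hc := KK_cos_pos hx'.1.le hlt
      have hl : 0 < 1 - 2 / π * x := by
        have : 2 / π * x < 2 / π * (π / 2) := by gcongr
        have h' : 2 / π * (π / 2) = 1 := by field_simp
        linarith
      rw [Real.norm_of_nonneg (by positivity), Real.norm_of_nonneg (by positivity)]
      exact Real.rpow_le_rpow_of_nonpos hl (Real.one_sub_mul_le_cos hx'.1.le hx'.2) h.le

lemma KK_int {p : ℝ} (hp : -1 < p) (b : ℝ) :
    IntervalIntegrable (fun x => Real.cos x ^ p * Real.cosh (2 * b * x)) volume 0 (π / 2) :=
  (KK_cos_int hp).mul_continuousOn (by fun_prop)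

lemma KK_pos {p : ℝ} (hp : -1 < p) (b : ℝ) : 0 < KK p b := by
  apply intervalIntegral.intervalIntegral_pos_of_pos_on (KK_int hp b)
  · intro x hx
    exact mul_pos (Real.rpow_pos_of_pos (KK_cos_pos hx.1.le hx.2) _) (Real.cosh_pos _)
  · exact Real.pi_div_two_pos

lemma KK_rec {p : ℝ} (hp : -1 < p) (b : ℝ) :
    ((p + 2) ^ 2 + 4 * b ^ 2) * KK (p + 2) b = (p + 1) * (p + 2) * KK p b := by
  have i1 := KK_int hp b
  have i2 := KK_int (p := p + 2) (by linarith) b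
  have key := intervalIntegral.integral_eq_sub_of_hasDerivAt_of_le
    (f := fun x => Real.cos x ^ (p + 2) * (2 * b * Real.sinh (2 * b * x)) +
      (p + 2) * (Real.cos x ^ (p + 1) * Real.sin x * Real.cosh (2 * b * x)))
    (f' := fun x => ((p + 2) ^ 2 + 4 * b ^ 2) * (Real.cos x ^ (p + 2) * Real.cosh (2 * b * x)) -
      (p + 1) * (p + 2) * (Real.cos x ^ p * Real.cosh (2 * b * x)))
    Real.pi_div_two_pos.le ?_ ?_ ((i2.const_mul _).sub (i1.const_mul _))
  · rw [intervalIntegral.integral_sub (i2.const_mul _) (i1.const_mul _),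
      intervalIntegral.integral_const_mul, intervalIntegral.integral_const_mul] at key
    simp only [Real.cos_pi_div_two, Real.sin_zero, mul_zero, Real.sinh_zero,
      Real.zero_rpow (by linarith : p + 2 ≠ 0), Real.zero_rpow (by linarith : p + 1 ≠ 0)] at key
    unfold KK
    linarith
  · apply Continuous.continuousOn
    have c1 := Real.continuous_cos.rpow_const (p := p + 2) (fun x => Or.inr (by linarith))
    have c2 := Real.continuous_cos.rpow_const (p := p + 1) (fun x => Or.inr (by linarith))
    fun_prop
  · intro x hx
    have hc := KK_cos_pos hx.1.le hx.2
    have d1 := (Real.hasDerivAt_cos x).rpow_const (p := p + 2) (Or.inl hc.ne')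
    have d2 := (Real.hasDerivAt_cos x).rpow_const (p := p + 1) (Or.inl hc.ne')
    have dl : HasDerivAt (fun x : ℝ => 2 * b * x) (2 * b) x := by
      simpa using (hasDerivAt_id x).const_mul (2 * b)
    have d := (d1.mul (dl.sinh.const_mul (2 * b))).add
      (((d2.mul (Real.hasDerivAt_sin x)).mul dl.cosh).const_mul (p + 2))
    refine d.congr_deriv ?_
    have e1 : Real.cos x ^ (p + 1) = Real.cos x ^ p * Real.cos x := by
      rw [Real.rpow_add hc, Real.rpow_one]
    have e2 : Real.cos x ^ (p + 2) = Real.cos x ^ p * Real.cos x ^ 2 := by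
      rw [Real.rpow_add hc]; norm_num
    have e3 : p + 2 - 1 = p + 1 := by ring
    have e4 : p + 1 - 1 = p := by ring
    simp only [Pi.mul_apply, e3, e4, e1, e2]
    have := Real.sin_sq x
    linear_combination (-(p+2)*(p+1) * Real.cos x ^ p * Real.cosh (2 * b * x)) * this

lemma KK_lim {q : ℝ} (hq : 0 < q) (b : ℝ) :
    Filter.Tendsto (fun n : ℕ => KK (q + 2 * n) b / KK (q + 2 * n) 0) Filter.atTop (nhds 1) := by
  have main : ∀ c : ℝ, Filter.Tendsto (fun n : ℕ => ((KK (q + 2 * n) c : ℝ) : ℂ) /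
      ((∫ x in (0:ℝ)..π / 2, Real.cos x ^ (2 * n) : ℝ) : ℂ)) Filter.atTop (nhds 1) := by
    intro c
    have c1 := Real.continuous_cos.rpow_const (p := q) (fun x => Or.inr hq.le)
    have hf : Continuous
      (fun x : ℝ => ((Real.cos x ^ q * Real.cosh (2 * c * x) : ℝ) : ℂ)) := by fun_prop
    have h := (EulerSine.tendsto_integral_cos_pow_mul_div hf.continuousOn).comp
      (Filter.tendsto_id.const_mul_atTop' (zero_lt_two (α := ℕ)))
    simp only [Real.cos_zero, Real.one_rpow, mul_zero, Real.cosh_zero, mul_one, ofReal_one] at h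
    refine h.congr (fun n => ?_)
    simp only [Function.comp_apply, id_eq]
    congr 1
    unfold KK
    rw [← intervalIntegral.integral_ofReal]
    apply intervalIntegral.integral_congr_ae
    have : ∀ᵐ x : ℝ, x ≠ π / 2 := by simp [ae_iff]
    filter_upwards [this] with x hx hx'
    rw [Set.uIoc_of_le (Real.pi_div_two_pos.le)] at hx'
    have hc := KK_cos_pos hx'.1.le (lt_of_le_of_ne hx'.2 hx)
    rw [Real.rpow_add hc, show (2 * (n:ℝ)) = ((2 * n : ℕ) : ℝ) by push_cast; ring,
      Real.rpow_natCast]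
    push_cast
    ring
  have h := (main b).div (main 0) one_ne_zero
  rw [div_one] at h
  have h2 := (Complex.continuous_re.tendsto _).comp h
  rw [Complex.one_re] at h2
  refine h2.congr (fun n => ?_)
  have hpos : 0 < ∫ x in (0:ℝ)..π / 2, Real.cos x ^ (2 * n) := by
    have := KK_pos (p := ((2 * n : ℕ) : ℝ)) (by have := Nat.cast_nonneg (α := ℝ) (2 * n); linarith) 0
    simpa [KK, Real.rpow_natCast, -Nat.cast_mul] using this
  simp only [Function.comp_apply, Pi.div_apply]
  rw [← ofReal_div, ← ofReal_div, ← ofReal_div, ofReal_re]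
  field_simp

lemma KK_prod {p : ℝ} (hp : -1 < p) (b : ℝ) (n : ℕ) :
    (∏ j ∈ Finset.range n, ((p / 2 + 1 + j) ^ 2 + b ^ 2)) * KK (p + 2 * n) b =
      (∏ j ∈ Finset.range n, ((p + 2 * j + 1) * (p + 2 * j + 2) / 4)) * KK p b := by
  induction n with
  | zero => simp
  | succ n ih =>
    have hn : (0:ℝ) ≤ n := Nat.cast_nonneg n
    have h := KK_rec (p := p + 2 * n) (by linarith) b
    rw [Finset.prod_range_succ, Finset.prod_range_succ]
    have e : p + 2 * ((n + 1 : ℕ) : ℝ) = p + 2 * n + 2 := by push_cast; ring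
    rw [e]
    linear_combination ((p + 2 * n + 1) * (p + 2 * n + 2) / 4) * ih +
      (∏ j ∈ Finset.range n, ((p / 2 + 1 + j) ^ 2 + b ^ 2)) / 4 * h

lemma KK_ratio {p : ℝ} (hp : -1 < p) (b : ℝ) (n : ℕ) :
    (∏ j ∈ Finset.range n, ((p / 2 + 1 + j) ^ 2)) * KK p b =
      (∏ j ∈ Finset.range n, ((p / 2 + 1 + j) ^ 2 + b ^ 2)) * KK p 0 *
        (KK (p + 2 * n) b / KK (p + 2 * n) 0) := by
  have hn : (0:ℝ) ≤ n := Nat.cast_nonneg n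
  have h1 := KK_prod hp b n
  have h0 := KK_prod hp 0 n
  simp only [ne_eq, OfNat.ofNat_ne_zero, not_false_eq_true, zero_pow, add_zero] at h0
  have hq : (∏ j ∈ Finset.range n, ((p + 2 * (j:ℝ) + 1) * (p + 2 * j + 2) / 4)) ≠ 0 := by
    apply Finset.prod_ne_zero_iff.2
    intro j _
    have hj : (0:ℝ) ≤ j := Nat.cast_nonneg j
    have a1 : 0 < p + 2 * j + 1 := by linarith
    have a2 : 0 < p + 2 * j + 2 := by linarith
    positivity
  have hk := (KK_pos (p := p + 2 * n) (by linarith) 0).ne'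
  rw [mul_div_assoc', eq_div_iff hk]
  apply mul_left_cancel₀ hq
  linear_combination (-∏ j ∈ Finset.range n, ((p / 2 + 1 + (j:ℝ)) ^ 2)) * KK (p + 2 * n) 0 * h1
    + (∏ j ∈ Finset.range n, ((p / 2 + 1 + (j:ℝ)) ^ 2 + b ^ 2)) * KK (p + 2 * n) b * h0

lemma KK_gamma (δ : ℂ) (hδ : -(1 / 2 : ℝ) < δ.re) :
    (KK (2 * δ.re) δ.im : ℂ) * (Complex.Gamma (1 + δ) * Complex.Gamma (1 + (starRingEnd ℂ) δ)) =
      (KK (2 * δ.re) 0 : ℂ) * (Complex.Gamma (1 + δ.re) * Complex.Gamma (1 + δ.re)) := by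
  have hp : -1 < 2 * δ.re := by linarith
  have t1 := ((Complex.GammaSeq_tendsto_Gamma (1 + δ)).mul
    (Complex.GammaSeq_tendsto_Gamma (1 + (starRingEnd ℂ) δ))).const_mul (KK (2 * δ.re) δ.im : ℂ)
  have t2 := ((Complex.GammaSeq_tendsto_Gamma (1 + δ.re)).mul
    (Complex.GammaSeq_tendsto_Gamma (1 + δ.re))).const_mul (KK (2 * δ.re) 0 : ℂ)
  have t3 := (Complex.continuous_ofReal.tendsto _).comp (KK_lim (q := 2 * δ.re + 2) (by linarith) δ.im)
  have t4 := t2.mul t3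
  rw [ofReal_one, mul_one] at t4
  refine tendsto_nhds_unique_of_eventuallyEq t1 t4 ?_
  filter_upwards [Filter.eventually_ne_atTop 0] with n hn
  have hnC : (n : ℂ) ≠ 0 := Nat.cast_ne_zero.2 hn
  have h := KK_ratio hp δ.im (n + 1)
  have hc : (2 * δ.re + 2 * ((n + 1 : ℕ) : ℝ)) = 2 * δ.re + 2 + 2 * n := by push_cast; ring
  rw [hc, show 2 * δ.re / 2 = δ.re by ring] at h
  simp only [Function.comp_apply]
  generalize KK (2 * δ.re + 2 + 2 * n) δ.im / KK (2 * δ.re + 2 + 2 * n) 0 = r at h ⊢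
  generalize KK (2 * δ.re) δ.im = A at h ⊢
  generalize KK (2 * δ.re) 0 = B at h ⊢
  have h' := congrArg (fun x : ℝ => (x : ℂ)) h
  push_cast at h'
  have hz : δ = δ.re + δ.im * I := (Complex.re_add_im δ).symm
  have hzc : (starRingEnd ℂ) δ = δ.re - δ.im * I := by
    apply Complex.ext <;> simp
  have e1 : (∏ j ∈ Finset.range (n + 1), (((δ.re : ℂ) + 1 + j) ^ 2 + (δ.im : ℂ) ^ 2)) =
      (∏ j ∈ Finset.range (n + 1), (1 + δ + j)) *
        (∏ j ∈ Finset.range (n + 1), (1 + (starRingEnd ℂ) δ + j)) := by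
    rw [← Finset.prod_mul_distrib]
    refine Finset.prod_congr rfl fun j _ => ?_
    rw [hzc]
    nth_rw 3 [hz]
    linear_combination ((δ.im : ℂ) ^ 2) * Complex.I_sq
  have e2 : (∏ j ∈ Finset.range (n + 1), ((δ.re : ℂ) + 1 + j) ^ 2) =
      (∏ j ∈ Finset.range (n + 1), (1 + (δ.re : ℂ) + j)) *
        (∏ j ∈ Finset.range (n + 1), (1 + (δ.re : ℂ) + j)) := by
    rw [← Finset.prod_mul_distrib]
    refine Finset.prod_congr rfl fun j _ => ?_
    ring
  rw [e1, e2] at h'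
  have nz : ∀ z : ℂ, -(1/2 : ℝ) < z.re → (∏ j ∈ Finset.range (n + 1), (1 + z + j)) ≠ 0 := by
    intro z hz
    apply Finset.prod_ne_zero_iff.2
    intro j _ h0
    have := congrArg Complex.re h0
    simp at this
    have hj : (0:ℝ) ≤ j := Nat.cast_nonneg j
    linarith
  have n1 := nz δ hδ
  have n2 := nz ((starRingEnd ℂ) δ) (by simpa using hδ)
  have n3 := nz (δ.re : ℂ) (by simpa using hδ)
  have e3 : (n : ℂ) ^ (1 + δ) * (n : ℂ) ^ (1 + (starRingEnd ℂ) δ) =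
      (n : ℂ) ^ (1 + (δ.re : ℂ)) * (n : ℂ) ^ (1 + (δ.re : ℂ)) := by
    rw [← Complex.cpow_add _ _ hnC, ← Complex.cpow_add _ _ hnC]
    congr 1
    rw [hzc]
    nth_rw 1 [hz]
    ring
  unfold Complex.GammaSeq
  generalize (∏ j ∈ Finset.range (n + 1), (1 + δ + j)) = P1 at *
  generalize (∏ j ∈ Finset.range (n + 1), (1 + (starRingEnd ℂ) δ + j)) = P2 at *
  generalize (∏ j ∈ Finset.range (n + 1), (1 + (δ.re : ℂ) + j)) = P3 at *
  generalize (n : ℂ) ^ (1 + δ) = N1 at *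
  generalize (n : ℂ) ^ (1 + (starRingEnd ℂ) δ) = N2 at *
  generalize (n : ℂ) ^ (1 + (δ.re : ℂ)) = N3 at *
  field_simp
  linear_combination (n.factorial : ℂ) ^ 2 * ((A : ℂ) * P3 ^ 2 * e3 + N3 ^ 2 * h')

lemma KK_zero {a : ℝ} (ha : -(1 / 2 : ℝ) < a) :
    (KK (2 * a) 0 : ℂ) * Complex.Gamma (1 + a) * 2 =
      √π * Complex.Gamma (a + 1 / 2) := by
  have hb := Complex.betaIntegral_eq_Gamma_mul_div (1 / 2) (a + 1 / 2) (by norm_num)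
    (by simp; linarith)
  have himg : (fun x : ℝ => Real.sin x ^ 2) '' Set.Ioo 0 (π / 2) = Set.Ioo 0 1 := by
    ext y
    constructor
    · rintro ⟨x, hx, rfl⟩
      have hs := Real.sin_pos_of_pos_of_lt_pi hx.1 (by linarith [hx.2, Real.pi_pos])
      have hc := KK_cos_pos hx.1.le hx.2
      have := Real.sin_sq_add_cos_sq x
      constructor
      · simp only; positivity
      · simp only; nlinarith
    · intro hy
      have h1 : 0 < √y := Real.sqrt_pos.2 hy.1
      have h2 : √y < 1 := by rw [Real.sqrt_lt' one_pos]; simpa using hy.2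
      refine ⟨Real.arcsin √y, ⟨Real.arcsin_pos.2 h1, Real.arcsin_lt_pi_div_two.2 h2⟩, ?_⟩
      simp only
      rw [Real.sin_arcsin (by linarith) h2.le, Real.sq_sqrt hy.1.le]
  have hinj : Set.InjOn (fun x : ℝ => Real.sin x ^ 2) (Set.Ioo 0 (π / 2)) := by
    intro x hx y hy h
    have hs := Real.sin_pos_of_pos_of_lt_pi hx.1 (by linarith [hx.2, Real.pi_pos])
    have hs' := Real.sin_pos_of_pos_of_lt_pi hy.1 (by linarith [hy.2, Real.pi_pos])
    have h3 : Real.sin x = Real.sin y := by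
      simp only at h
      exact (pow_left_inj₀ hs.le hs'.le two_ne_zero).1 h
    exact Real.injOn_sin ⟨by linarith [hx.1, Real.pi_pos], hx.2.le⟩
      ⟨by linarith [hy.1, Real.pi_pos], hy.2.le⟩ h3
  have hder : ∀ x ∈ Set.Ioo 0 (π / 2), HasDerivWithinAt (fun x : ℝ => Real.sin x ^ 2)
      (2 * Real.sin x * Real.cos x) (Set.Ioo 0 (π / 2)) x := by
    intro x _
    have h := ((Real.hasDerivAt_sin x).pow 2).hasDerivWithinAt (s := Set.Ioo 0 (π / 2))
    refine h.congr_deriv ?_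
    simp
  have hcv := integral_image_eq_integral_abs_deriv_smul measurableSet_Ioo hder hinj
    (fun x : ℝ => (x : ℂ) ^ ((1 / 2 : ℂ) - 1) * (1 - (x : ℂ)) ^ ((a + 1 / 2 : ℂ) - 1))
  rw [himg] at hcv
  have hbeta : Complex.betaIntegral (1 / 2) (a + 1 / 2) = 2 * (KK (2 * a) 0 : ℂ) := by
    unfold Complex.betaIntegral KK
    rw [intervalIntegral.integral_of_le zero_le_one, integral_Ioc_eq_integral_Ioo, hcv,
      intervalIntegral.integral_of_le Real.pi_div_two_pos.le, integral_Ioc_eq_integral_Ioo,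
      ← integral_complex_ofReal, ← MeasureTheory.integral_const_mul]
    apply setIntegral_congr_fun measurableSet_Ioo
    intro x hx
    have hs := Real.sin_pos_of_pos_of_lt_pi hx.1 (by linarith [hx.2, Real.pi_pos])
    have hc := KK_cos_pos hx.1.le hx.2
    simp only
    rw [abs_of_pos (by positivity), real_smul]
    have e1 : (((Real.sin x ^ 2 : ℝ)) : ℂ) ^ ((1 / 2 : ℂ) - 1) = ((Real.sin x)⁻¹ : ℝ) := by
      rw [show ((1 / 2 : ℂ) - 1) = ((-(1 / 2) : ℝ) : ℂ) by push_cast; ring,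
        ← Complex.ofReal_cpow (by positivity), ← Real.rpow_natCast, ← Real.rpow_mul hs.le,
        ← Real.rpow_neg_one]
      norm_num
    have e2 : (1 - ((Real.sin x ^ 2 : ℝ) : ℂ)) ^ ((a + 1 / 2 : ℂ) - 1) =
        ((Real.cos x ^ (2 * a) * (Real.cos x)⁻¹ : ℝ) : ℂ) := by
      rw [show (1 - ((Real.sin x ^ 2 : ℝ) : ℂ)) = ((Real.cos x ^ 2 : ℝ) : ℂ) by
          rw [Real.cos_sq']; push_cast; ring,
        show ((a + 1 / 2 : ℂ) - 1) = ((a - 1 / 2 : ℝ) : ℂ) by push_cast; ring,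
        ← Complex.ofReal_cpow (by positivity), ← Real.rpow_natCast, ← Real.rpow_mul hc.le,
        ← Real.rpow_neg_one (Real.cos x), ← Real.rpow_add hc]
      congr 2
      push_cast; ring
    rw [e1, e2]
    have hsC : (Real.sin x : ℂ) ≠ 0 := ofReal_ne_zero.2 hs.ne'
    have hcC : (Real.cos x : ℂ) ≠ 0 := ofReal_ne_zero.2 hc.ne'
    simp only [ofReal_mul, ofReal_inv, mul_zero, zero_mul, Real.cosh_zero, ofReal_one]
    push_cast at hsC hcC ⊢
    field_simp
  rw [hbeta] at hb
  have hne : Complex.Gamma (1 + a) ≠ 0 := Complex.Gamma_ne_zero_of_re_pos (by simp; linarith)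
  rw [show (1 / 2 + ((a : ℂ) + 1 / 2)) = 1 + a by ring, eq_div_iff hne] at hb
  rw [Complex.Gamma_one_half_eq] at hb
  have hpi : ((π : ℂ)) ^ (1 / 2 : ℂ) = ((√π : ℝ) : ℂ) := by
    rw [Real.sqrt_eq_rpow, Complex.ofReal_cpow Real.pi_pos.le]; norm_num
  rw [hpi] at hb
  linear_combination hb

lemma integrand_eq (δ : ℂ) {φ : ℝ} (h0 : -(π / 2) < φ) (h1 : φ < π / 2) :
    ((1 - Complex.exp (Complex.I * ((2 * φ + π : ℝ) : ℂ))) ^ ((starRingEnd ℂ) δ) *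
            (1 - Complex.exp (-(Complex.I * ((2 * φ + π : ℝ) : ℂ)))) ^ δ) =
      (((2:ℝ) ^ (2 * δ.re) * (Real.cos φ ^ (2 * δ.re) * Real.exp (2 * δ.im * φ)) : ℝ) : ℂ) := by
  have hc : 0 < Real.cos φ := Real.cos_pos_of_mem_Ioo ⟨h0, h1⟩
  have hr : 0 < 2 * Real.cos φ := by positivity
  have f1 : 1 - Complex.exp (Complex.I * ((2 * φ + π : ℝ) : ℂ)) =
      ((2 * Real.cos φ : ℝ) : ℂ) * Complex.exp (φ * I) := by
    have : Complex.I * ((2 * φ + π : ℝ) : ℂ) = φ * I + φ * I + π * I := by push_cast; ring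
    rw [this, Complex.exp_add, Complex.exp_pi_mul_I]
    push_cast
    rw [Complex.two_cos, add_mul, ← Complex.exp_add, ← Complex.exp_add,
      show -(φ : ℂ) * I + φ * I = 0 by ring, Complex.exp_zero]
    ring
  have f2 : 1 - Complex.exp (-(Complex.I * ((2 * φ + π : ℝ) : ℂ))) =
      ((2 * Real.cos φ : ℝ) : ℂ) * Complex.exp ((-φ : ℝ) * I) := by
    have : -(Complex.I * ((2 * φ + π : ℝ) : ℂ)) = -φ * I + -φ * I + -(π * I) := by push_cast; ring
    rw [this, Complex.exp_add, Complex.exp_neg (π * I), Complex.exp_pi_mul_I]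
    push_cast
    rw [Complex.two_cos, add_mul, ← Complex.exp_add, ← Complex.exp_add,
      show (φ : ℂ) * I + -φ * I = 0 by ring, Complex.exp_zero]
    norm_num
  have hlog : ∀ ψ : ℝ, -(π / 2) < ψ → ψ < π / 2 →
      Complex.log (((2 * Real.cos φ : ℝ) : ℂ) * Complex.exp (ψ * I)) =
        (Real.log (2 * Real.cos φ) : ℂ) + ψ * I := by
    intro ψ h h'
    rw [Complex.log_ofReal_mul hr (Complex.exp_ne_zero _), Complex.log_exp]
    · simp; linarith [Real.pi_pos]
    · simp; linarith [Real.pi_pos]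
  have hrC : ((2 * Real.cos φ : ℝ) : ℂ) ≠ 0 := ofReal_ne_zero.2 hr.ne'
  rw [f1, f2, Complex.cpow_def_of_ne_zero (mul_ne_zero hrC (Complex.exp_ne_zero _)),
    Complex.cpow_def_of_ne_zero (mul_ne_zero hrC (Complex.exp_ne_zero _)),
    hlog φ h0 h1, hlog (-φ) (by linarith) (by linarith), ← Complex.exp_add, ← mul_assoc,
    ← Real.mul_rpow (by norm_num) hc.le, Real.rpow_def_of_pos hr, ← Real.exp_add, Complex.ofReal_exp]
  congr 1
  apply Complex.ext
  · simp; ring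
  · simp; ring

lemma main_int (δ : ℂ) (hδ : -(1 / 2 : ℝ) < δ.re) :
    ∫ θ in (0:ℝ)..(2 * Real.pi),
          ((1 - Complex.exp (Complex.I * θ)) ^ ((starRingEnd ℂ) δ) *
            (1 - Complex.exp (-(Complex.I * θ))) ^ δ) =
      ((4 * (2:ℝ) ^ (2 * δ.re) * KK (2 * δ.re) δ.im : ℝ) : ℂ) := by
  have hp : -1 < 2 * δ.re := by linarith
  have hs := intervalIntegral.integral_comp_mul_add (a := -(π / 2)) (b := π / 2)
    (fun θ : ℝ => ((1 - Complex.exp (Complex.I * θ)) ^ ((starRingEnd ℂ) δ) *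
            (1 - Complex.exp (-(Complex.I * θ))) ^ δ)) (two_ne_zero (α := ℝ)) π
  rw [show 2 * -(π / 2) + π = 0 by ring, show 2 * (π / 2) + π = 2 * π by ring] at hs
  have hs' := congrArg (fun z => (2:ℝ) • z) hs
  simp only [smul_smul] at hs'
  norm_num at hs'
  have hne : ∀ᵐ x : ℝ, x ≠ π / 2 := by simp [ae_iff]
  have hcong : ∫ φ in -(π / 2)..(π / 2),
      ((1 - Complex.exp (Complex.I * ((2 * φ + π : ℝ) : ℂ))) ^ ((starRingEnd ℂ) δ) *
            (1 - Complex.exp (-(Complex.I * ((2 * φ + π : ℝ) : ℂ)))) ^ δ) =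
      ∫ φ in -(π / 2)..(π / 2),
      (((2:ℝ) ^ (2 * δ.re) * (Real.cos φ ^ (2 * δ.re) * Real.exp (2 * δ.im * φ)) : ℝ) : ℂ) := by
    apply intervalIntegral.integral_congr_ae
    filter_upwards [hne] with x hx hx'
    rw [Set.uIoc_of_le (by linarith [Real.pi_pos])] at hx'
    exact integrand_eq δ hx'.1 (lt_of_le_of_ne hx'.2 hx)
  push_cast at hcong
  rw [hcong] at hs'
  rw [← hs']
  have i1 : ∀ b : ℝ, IntervalIntegrable
      (fun φ => Real.cos φ ^ (2 * δ.re) * Real.exp (2 * b * φ)) volume 0 (π / 2) :=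
    fun b => (KK_cos_int hp).mul_continuousOn (by fun_prop)
  have i2 : IntervalIntegrable
      (fun φ => Real.cos φ ^ (2 * δ.re) * Real.exp (2 * δ.im * φ)) volume (-(π / 2)) 0 := by
    have h := (i1 (-δ.im)).comp_sub_left 0
    simp only [zero_sub, Real.cos_neg, sub_zero] at h
    refine h.symm.congr ?_
    intro x _
    simp only
    ring_nf
  have hr : ∫ φ in -(π / 2)..(π / 2), Real.cos φ ^ (2 * δ.re) * Real.exp (2 * δ.im * φ) =
      2 * KK (2 * δ.re) δ.im := by
    rw [← intervalIntegral.integral_add_adjacent_intervals i2 (i1 δ.im)]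
    have h := intervalIntegral.integral_comp_neg (a := 0) (b := π / 2)
      (fun φ => Real.cos φ ^ (2 * δ.re) * Real.exp (2 * δ.im * φ))
    rw [neg_zero] at h
    rw [← h, ← intervalIntegral.integral_add ?_ (i1 δ.im)]
    · unfold KK
      rw [← intervalIntegral.integral_const_mul]
      congr 1
      ext x
      rw [Real.cos_neg, Real.cosh_eq, mul_neg]
      ring
    · have := i1 (-δ.im)
      refine this.congr ?_
      intro x _
      simp only [Real.cos_neg]
      ring_nf
  have : ∫ φ in -(π / 2)..(π / 2),
      (((2:ℝ) ^ (2 * δ.re) * (Real.cos φ ^ (2 * δ.re) * Real.exp (2 * δ.im * φ)) : ℝ) : ℂ) =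
      (((2:ℝ) ^ (2 * δ.re) * (2 * KK (2 * δ.re) δ.im) : ℝ) : ℂ) := by
    rw [intervalIntegral.integral_ofReal, intervalIntegral.integral_const_mul, hr]
  push_cast at this ⊢
  rw [this]
  ring

/-- Normalization of the density `λ^{(δ)}` on the circle: for `Re δ > -1/2`,
`(1/2π) ∫₀^{2π} (1-e^{iθ})^{conj δ} (1-e^{-iθ})^{δ} dθ
  = Γ(1+δ+conj δ)/(Γ(1+δ)Γ(1+conj δ))`; consequently
`λ^{(δ)}(ζ) = [Γ(1+δ)Γ(1+conj δ)/Γ(1+δ+conj δ)] (1-ζ)^{conj δ}(1-conj ζ)^{δ}`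
is a probability density with respect to the normalized arc-length measure. -/
theorem lambda_delta_normalization (δ : ℂ) (hδ : -(1 / 2 : ℝ) < δ.re) :
    ((1 / (2 * Real.pi) : ℝ) : ℂ) *
        ∫ θ in (0:ℝ)..(2 * Real.pi),
          ((1 - Complex.exp (Complex.I * θ)) ^ ((starRingEnd ℂ) δ) *
            (1 - Complex.exp (-(Complex.I * θ))) ^ δ) =
      Complex.Gamma (1 + δ + (starRingEnd ℂ) δ) /
        (Complex.Gamma (1 + δ) * Complex.Gamma (1 + (starRingEnd ℂ) δ)) ∧
    ((1 / (2 * Real.pi) : ℝ) : ℂ) *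
        ∫ θ in (0:ℝ)..(2 * Real.pi),
          (Complex.Gamma (1 + δ) * Complex.Gamma (1 + (starRingEnd ℂ) δ) /
              Complex.Gamma (1 + δ + (starRingEnd ℂ) δ) *
            ((1 - Complex.exp (Complex.I * θ)) ^ ((starRingEnd ℂ) δ) *
              (1 - Complex.exp (-(Complex.I * θ))) ^ δ)) = 1 := by
  have hp : -1 < 2 * δ.re := by linarith
  have hz : δ + (starRingEnd ℂ) δ = 2 * (δ.re : ℂ) := by
    rw [Complex.add_conj]; push_cast; ring
  have g1 : Complex.Gamma (1 + δ) ≠ 0 :=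
    Complex.Gamma_ne_zero_of_re_pos (by simp; linarith)
  have g2 : Complex.Gamma (1 + (starRingEnd ℂ) δ) ≠ 0 :=
    Complex.Gamma_ne_zero_of_re_pos (by simp; linarith)
  have g3 : Complex.Gamma (1 + δ + (starRingEnd ℂ) δ) ≠ 0 :=
    Complex.Gamma_ne_zero_of_re_pos (by simp; linarith)
  have g4 : Complex.Gamma (1 + δ.re) ≠ 0 :=
    Complex.Gamma_ne_zero_of_re_pos (by simp; linarith)
  have hpiC : (π : ℂ) ≠ 0 := ofReal_ne_zero.2 Real.pi_ne_zero
  have key : ((1 / (2 * Real.pi) : ℝ) : ℂ) *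
        ∫ θ in (0:ℝ)..(2 * Real.pi),
          ((1 - Complex.exp (Complex.I * θ)) ^ ((starRingEnd ℂ) δ) *
            (1 - Complex.exp (-(Complex.I * θ))) ^ δ) =
      Complex.Gamma (1 + δ + (starRingEnd ℂ) δ) /
        (Complex.Gamma (1 + δ) * Complex.Gamma (1 + (starRingEnd ℂ) δ)) := by
    rw [main_int δ hδ, eq_div_iff (mul_ne_zero g1 g2)]
    have k1 := KK_gamma δ hδ
    have k2 := KK_zero hδ
    have k3 := Complex.Gamma_mul_Gamma_add_half ((δ.re : ℂ) + 1 / 2)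
    rw [show ((δ.re : ℂ) + 1 / 2 + 1 / 2) = 1 + δ.re by ring,
      show (2 * ((δ.re : ℂ) + 1 / 2)) = 1 + δ + (starRingEnd ℂ) δ by
        rw [add_assoc, hz]; ring] at k3
    have k4 : (2 : ℂ) ^ (1 - (1 + δ + (starRingEnd ℂ) δ)) * (((2:ℝ) ^ (2 * δ.re) : ℝ) : ℂ) = 1 := by
      rw [Complex.ofReal_cpow (by norm_num)]
      push_cast
      rw [← Complex.cpow_add _ _ two_ne_zero, add_assoc, hz]
      ring_nf
      simp
    have k5 : ((√π : ℝ) : ℂ) * ((√π : ℝ) : ℂ) = π := by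
      rw [← ofReal_mul, Real.mul_self_sqrt Real.pi_pos.le]
    rw [ofReal_div, ofReal_mul, ofReal_mul, ofReal_mul]
    push_cast at k4 ⊢
    generalize (((2:ℝ) ^ (2 * δ.re) : ℝ) : ℂ) = T at *
    generalize (2 : ℂ) ^ (1 - (1 + δ + (starRingEnd ℂ) δ)) = T' at *
    field_simp
    linear_combination 4 * T * k1 + 2 * T * Complex.Gamma (1 + δ.re) * k2 + 2 * T * √π * k3
      + 2 * Complex.Gamma (1 + δ + (starRingEnd ℂ) δ) * T * T' * k5
      + 2 * Complex.Gamma (1 + δ + (starRingEnd ℂ) δ) * π * k4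
  refine ⟨key, ?_⟩
  rw [intervalIntegral.integral_const_mul, mul_left_comm, key]
  field_simp
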